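/- arXiv:1801.08134 — 3 statements merged into one kernel-verified Lean document; each statement's English description precedes it below -/
import Mathlib

section
/- For every step size h > 0, the explicit Euler iterates y_j for y' = f(x,y), y(0) = 0, satisfy the error bound |y_j − φ₁(x_j)| = h·x_j/4 for all j ∈ ℕ, where φ₁(x) = x²/4 and x_j = j·h; consequently, on any fixed interval [0,T] the Euler polygon values converge uniformly to φ₁ (and not to the second solution φ₂) as h → 0. -/
open Set

/-- The piecewise right-hand side of Example 1:
`f(x,y) = x/2` if `y ≤ x²/2`, `f(x,y) = x/2 + 5(y - x²/2)/x` if `x²/2 < y < x²`,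
and `f(x,y) = 3x` if `y ≥ x²`.  (For `x = 0` the middle region is empty and
`f(0,y) = 0` for all `y ≥ 0`.) -/
noncomputable def f (x y : ℝ) : ℝ :=
  if y ≤ x ^ 2 / 2 then x / 2
  else if y < x ^ 2 then x / 2 + 5 * (y - x ^ 2 / 2) / x
  else 3 * x

/-- The explicit Euler iterates for `y' = f(x,y)`, `y(0) = 0`, with step size `h`:
`x_j = j·h`, `y₀ = 0`, `y_{j+1} = y_j + h·f(x_j, y_j)`. -/
noncomputable def eulerY (h : ℝ) : ℕ → ℝ
  | 0 => 0
  | j + 1 => eulerY h j + h * f ((j : ℝ) * h) (eulerY h j)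

/-- The Euler iterates stay in the region `y ≤ x² / 2`, so they only see the branch `f(x,y) = x / 2`,
which gives them in closed form. -/
theorem eulerY_eq (h : ℝ) (j : ℕ) :
    eulerY h j = ((j : ℝ) * h) ^ 2 / 4 - h * ((j : ℝ) * h) / 4 := by
  induction j with
  | zero => simp [eulerY]
  | succ j ih =>
    have hle : eulerY h j ≤ ((j : ℝ) * h) ^ 2 / 2 := by
      have : 0 ≤ (j : ℝ) * h ^ 2 := by positivity
      rw [ih]
      nlinarith [sq_nonneg ((j : ℝ) * h)]
    rw [eulerY, f, if_pos hle, ih]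
    push_cast
    ring

/-- For every step size `h > 0`, the explicit Euler iterates satisfy the error bound
`|y_j − φ₁(x_j)| = h·x_j/4` for all `j`, where `φ₁(x) = x²/4` and `x_j = j·h`;
consequently, on any fixed interval `[0,T]` the Euler polygon values converge
uniformly to `φ₁` (and not to `φ₂`) as `h → 0`. -/
theorem euler_converges_to_phi1 :
    (∀ h : ℝ, 0 < h → ∀ j : ℕ,
      |eulerY h j - ((j : ℝ) * h) ^ 2 / 4| = h * ((j : ℝ) * h) / 4) ∧
    ∀ T : ℝ, 0 < T → ∀ ε : ℝ, 0 < ε → ∃ δ : ℝ, 0 < δ ∧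
      ∀ h : ℝ, 0 < h → h < δ → ∀ j : ℕ, (j : ℝ) * h ≤ T →
        |eulerY h j - ((j : ℝ) * h) ^ 2 / 4| < ε := by
  have error_eq : ∀ h : ℝ, 0 < h → ∀ j : ℕ,
      |eulerY h j - ((j : ℝ) * h) ^ 2 / 4| = h * ((j : ℝ) * h) / 4 := by
    intro h hh j
    rw [eulerY_eq, sub_sub_cancel_left, abs_neg, abs_of_nonneg (by positivity)]
  refine ⟨error_eq, fun T hT ε hε => ⟨ε / T, by positivity, fun h hh hδ j hj => ?_⟩⟩
  rw [error_eq h hh j]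
  have hεT : h * T < ε := (lt_div_iff₀ hT).mp hδ
  have hle : h * ((j : ℝ) * h) ≤ h * T := mul_le_mul_of_nonneg_left hj hh.le
  linarith
end

section
/- For every step size h with 0 < h ≤ 1, the pushed Euler iterates y_j with K = 1 satisfy |y_j − φ₂(x_j)| ≤ h·(1 + 3·x_j/2) for all j ≥ 1, where φ₂(x) = 3x²/2 and x_j = j·h; consequently, on any fixed interval [0,T] the pushed Euler polygon values converge uniformly to the second solution φ₂ as h → 0. -/
open Set

/-- The pushed Euler iterates (PushEuler with push constant `K = 1`) for
`y' = f(x,y)`, `y(0) = 0`, with step size `h`: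
`x_j = j·h`, `y₀ = 0`, `y₁ = y₀ + K·h = h`, and `y_{j+1} = y_j + h·f(x_j, y_j)` for `j ≥ 1`. -/
noncomputable def pushY (h : ℝ) : ℕ → ℝ
  | 0 => 0
  | 1 => h
  | j + 2 => pushY h (j + 1) + h * f (((j : ℝ) + 1) * h) (pushY h (j + 1))

theorem f_of_sq_le {x y : ℝ} (hx : 0 < x) (hy : x ^ 2 ≤ y) : f x y = 3 * x := by
  have hlt : ¬ y ≤ x ^ 2 / 2 := by
    have := pow_pos hx 2
    linarith
  rw [f, if_neg hlt, if_neg hy.not_gt]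

/-- After the push the iterates stay in the region `y ≥ x²`, where `f(x,y) = 3x`. -/
theorem pushY_succ {h : ℝ} (h0 : 0 < h) (h1 : h ≤ 1) (n : ℕ) :
    pushY h (n + 1) = h + 3 * h ^ 2 * ((n + 1) * n) / 2 := by
  induction n with
  | zero => simp [pushY]
  | succ n ih =>
    have hn : (0 : ℝ) ≤ n * (n - 1) := by
      rcases n with _ | m
      · simp
      · push_cast
        rw [add_sub_cancel_right]
        positivity
    have hsq : (((n : ℝ) + 1) * h) ^ 2 ≤ pushY h (n + 1) := by
      rw [ih]
      nlinarith [mul_nonneg (sq_nonneg h) hn, mul_nonneg h0.le (sub_nonneg.2 h1)]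
    rw [pushY, f_of_sq_le (by positivity) hsq, ih]
    push_cast
    ring

theorem abs_pushY_sub_le {h : ℝ} (h0 : 0 < h) (h1 : h ≤ 1) {j : ℕ} (hj : 1 ≤ j) :
    |pushY h j - 3 * ((j : ℝ) * h) ^ 2 / 2| ≤ h * (1 + 3 * ((j : ℝ) * h) / 2) := by
  obtain ⟨n, rfl⟩ := Nat.exists_eq_add_of_le' hj
  have hpos : 0 ≤ h * (((n : ℝ) + 1) * h) := by positivity
  rw [pushY_succ h0 h1, abs_le]
  push_cast
  constructor <;> nlinarith

/-- For every step size `0 < h ≤ 1`, the pushed Euler iterates with `K = 1` satisfy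
`|y_j − φ₂(x_j)| ≤ h·(1 + 3·x_j/2)` for all `j ≥ 1`, where `φ₂(x) = 3x²/2` and
`x_j = j·h`; consequently, on any fixed interval `[0,T]` the pushed Euler polygon
values converge uniformly to the second solution `φ₂` as `h → 0`. -/
theorem pushEuler_converges_to_phi2 :
    (∀ h : ℝ, 0 < h → h ≤ 1 → ∀ j : ℕ, 1 ≤ j →
      |pushY h j - 3 * ((j : ℝ) * h) ^ 2 / 2| ≤ h * (1 + 3 * ((j : ℝ) * h) / 2)) ∧
    ∀ T : ℝ, 0 < T → ∀ ε : ℝ, 0 < ε → ∃ δ : ℝ, 0 < δ ∧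
      ∀ h : ℝ, 0 < h → h ≤ 1 → h < δ → ∀ j : ℕ, (j : ℝ) * h ≤ T →
        |pushY h j - 3 * ((j : ℝ) * h) ^ 2 / 2| < ε := by
  refine ⟨fun h h0 h1 j hj => abs_pushY_sub_le h0 h1 hj, fun T hT ε hε => ?_⟩
  have hC : 0 < 1 + 3 * T / 2 := by positivity
  refine ⟨ε / (1 + 3 * T / 2), div_pos hε hC, fun h h0 h1 hδ j hjT => ?_⟩
  rcases Nat.eq_zero_or_pos j with rfl | hj
  · simpa [pushY] using hε
  · calc |pushY h j - 3 * ((j : ℝ) * h) ^ 2 / 2|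
        ≤ h * (1 + 3 * ((j : ℝ) * h) / 2) := abs_pushY_sub_le h0 h1 hj
      _ ≤ h * (1 + 3 * T / 2) := by gcongr
      _ < ε := (lt_div_iff₀ hC).1 hδ
end

section
/- For every x ∈ [−1,1] the function y ↦ F(x,y) is Lipschitz continuous on ℝ: there exists L > 0 (depending on x) such that |F(x,y₁) − F(x,y₂)| ≤ L·|y₁ − y₂| for all y₁, y₂ ∈ ℝ. -/
open Set

/-- The extension `F : [−1,1] × ℝ → ℝ`:
`F(x,y) = 0` if `x < 0`; `F(x,y) = x/2` if `x ≥ 0` and `y < 0`;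
`F(x,y) = f(x,y)` if `x ≥ 0` and `y ≥ 0`. -/
noncomputable def F (x y : ℝ) : ℝ :=
  if x < 0 then 0 else if y < 0 then x / 2 else f x y

/-- For `x > 0`, `F x` is an affine function of `y - x² / 2` clamped to `[0, x² / 2]`. -/
theorem F_eq_clamp {x : ℝ} (hx : 0 < x) (y : ℝ) :
    F x y = x / 2 + 5 / x * max 0 (min (y - x ^ 2 / 2) (x ^ 2 / 2)) := by
  have hx2 : 0 < x ^ 2 := by positivity
  unfold F f
  rw [if_neg hx.not_gt]
  split_ifs with h₀ h₁ h₂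
  · rw [max_eq_left (min_le_of_left_le (by linarith))]
    ring
  · rw [max_eq_left (min_le_of_left_le (by linarith))]
    ring
  · rw [min_eq_left (by linarith), max_eq_right (by linarith)]
    ring
  · rw [min_eq_right (by linarith), max_eq_right (by linarith)]
    field_simp
    ring

/-- For `x ≤ 0`, `F x` vanishes identically. -/
theorem F_eq_zero_of_nonpos {x : ℝ} (hx : x ≤ 0) (y : ℝ) : F x y = 0 := by
  rcases hx.lt_or_eq with h | rfl
  · simp [F, h]
  · simp [F, f]

/-- Clamping a real number from above and below is `1`-Lipschitz. -/
theorem abs_clamp_sub_clamp_le (a b c d : ℝ) :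
    |max a (min c b) - max a (min d b)| ≤ |c - d| := by
  refine (abs_max_sub_max_le_max a _ a _).trans ?_
  refine max_le (by simp) ((abs_min_sub_min_le_max c b d b).trans (by simp))

/-- For every `x ∈ [−1,1]` the function `y ↦ F(x,y)` is Lipschitz continuous on `ℝ`. -/
theorem F_lipschitz_in_y :
    ∀ x ∈ Set.Icc (-1:ℝ) 1, ∃ L : ℝ, 0 < L ∧
      ∀ y₁ y₂ : ℝ, |F x y₁ - F x y₂| ≤ L * |y₁ - y₂| := by
  intro x _
  rcases le_or_gt x 0 with hx | hx
  · exact ⟨1, one_pos, fun y₁ y₂ => by simp [F_eq_zero_of_nonpos hx]⟩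
  · refine ⟨5 / x, by positivity, fun y₁ y₂ => ?_⟩
    rw [F_eq_clamp hx, F_eq_clamp hx, add_sub_add_left_eq_sub, ← mul_sub, abs_mul,
      abs_of_pos (by positivity : 0 < 5 / x)]
    refine mul_le_mul_of_nonneg_left ?_ (by positivity)
    exact (abs_clamp_sub_clamp_le _ _ _ _).trans_eq (by rw [sub_sub_sub_cancel_right])
end
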